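/- Let (Σ,σ) be a topologically transitive countable Markov shift with the F-property and φ : Σ → ℝ a potential with summable variations and P(φ) = 0. Let ξ : Σ → ℝ be such that φ' := φ + ξ − ξ∘σ has summable variations. If δ_{φ,∞} < 0, then δ_{φ',∞} < 0. -/

import Mathlib

open Filter Set MeasureTheory Real ENNReal

namespace CMS

/-- Points of the full sequence space over the alphabet `ℕ`. -/
abbrev Pt : Type := ℕ → ℕ

/-- The (left) shift map `σ`. -/
def shiftMap : Pt → Pt := fun x i => x (i + 1)

/-- `x` is a point of the countable Markov shift `Σ` determined by the
transition matrix `M` (identified with a relation on the alphabet `ℕ`). -/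
def isAdmissible (M : ℕ → ℕ → Prop) (x : Pt) : Prop := ∀ i, M (x i) (x (i + 1))

/-- Topological transitivity: for all states `a, b` there is `N` with
`[a] ∩ σ⁻ᴺ [b] ≠ ∅`. -/
def TopTransitive (M : ℕ → ℕ → Prop) : Prop :=
  ∀ a b : ℕ, ∃ (N : ℕ) (x : Pt), isAdmissible M x ∧ x 0 = a ∧ x N = b

/-- Birkhoff sum `S_n φ`. -/
noncomputable def birkhoff (φ : Pt → ℝ) (n : ℕ) (x : Pt) : ℝ :=
  ∑ i ∈ Finset.range n, φ (shiftMap^[i] x)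

/-- `φ` has summable variations: `∑_{k ≥ 2} var_k(φ) < ∞`, expressed via a summable
sequence dominating the `k`-th variations. -/
def SummableVariations (M : ℕ → ℕ → Prop) (φ : Pt → ℝ) : Prop :=
  ∃ V : ℕ → ℝ, Summable V ∧
    ∀ k, 2 ≤ k → ∀ x y : Pt, isAdmissible M x → isAdmissible M y →
      (∀ i < k, x i = y i) → |φ x - φ y| ≤ V k

/-- `φ` is weakly Hölder continuous: `var_k(φ) ≤ C θ^k` for all `k ≥ 2`. -/
def WeaklyHolder (M : ℕ → ℕ → Prop) (φ : Pt → ℝ) : Prop :=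
  ∃ C θ : ℝ, 0 < C ∧ 0 < θ ∧ θ < 1 ∧
    ∀ k, 2 ≤ k → ∀ x y : Pt, isAdmissible M x → isAdmissible M y →
      (∀ i < k, x i = y i) → |φ x - φ y| ≤ C * θ ^ k

/-- Periodic points of period `n` in the 1-cylinder `[a]`. -/
def PerSet (M : ℕ → ℕ → Prop) (a n : ℕ) : Set Pt :=
  {x | isAdmissible M x ∧ shiftMap^[n] x = x ∧ x 0 = a}

/-- Periodic points of period `n` in `[a]` whose first return time to `[a]` is `n`. -/
def PerStarSet (M : ℕ → ℕ → Prop) (a n : ℕ) : Set Pt :=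
  {x | isAdmissible M x ∧ shiftMap^[n] x = x ∧ x 0 = a ∧ ∀ k, 0 < k → k < n → x k ≠ a}

/-- The Gurevich partition function `Z_n(φ, a)`. -/
noncomputable def Zn (M : ℕ → ℕ → Prop) (φ : Pt → ℝ) (a n : ℕ) : ℝ≥0∞ :=
  ∑' x : PerSet M a n, ENNReal.ofReal (Real.exp (birkhoff φ n x.1))

/-- The first-return partition function `Z_n^*(φ, a)`. -/
noncomputable def ZnStar (M : ℕ → ℕ → Prop) (φ : Pt → ℝ) (a n : ℕ) : ℝ≥0∞ :=
  ∑' x : PerStarSet M a n, ENNReal.ofReal (Real.exp (birkhoff φ n x.1))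

/-- The Gurevich pressure at the state `a`:
`P(φ) = limsup_n (1/n) log Z_n(φ, a)`, with values in `EReal`. -/
noncomputable def pressureAt (M : ℕ → ℕ → Prop) (φ : Pt → ℝ) (a : ℕ) : EReal :=
  Filter.limsup (fun n : ℕ => ((n : ℝ)⁻¹ : EReal) * ENNReal.log (Zn M φ a n)) atTop

/-- `limsup_n (1/n) log Z_n^*(φ, a)`, with values in `EReal`. -/
noncomputable def pressureStarAt (M : ℕ → ℕ → Prop) (φ : Pt → ℝ) (a : ℕ) : EReal :=
  Filter.limsup (fun n : ℕ => ((n : ℝ)⁻¹ : EReal) * ENNReal.log (ZnStar M φ a n)) atTop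

/-- Strong positive recurrence of `φ`, relative to the common value `P` of the
Gurevich pressure: for some state `a`, `limsup_n (1/n) log Z_n^*(φ,a) < P(φ)`. -/
def SPR (M : ℕ → ℕ → Prop) (φ : Pt → ℝ) (P : ℝ) : Prop :=
  ∃ a : ℕ, pressureStarAt M φ a < (P : EReal)

/-- The `F`-property: for every state `a` and every `n ≥ 1` there are only finitely
many periodic points of period `n` in `[a]`. -/
def FProperty (M : ℕ → ℕ → Prop) : Prop :=
  ∀ a n : ℕ, 0 < n → (PerSet M a n).Finite

/-- `χ_per(φ) = sup { (1/n) S_n φ(x) : σ^n x = x, n ∈ ℕ }`, with values in `EReal`. -/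
noncomputable def chiPer (M : ℕ → ℕ → Prop) (φ : Pt → ℝ) : EReal :=
  ⨆ p : {p : Pt × ℕ // isAdmissible M p.1 ∧ 0 < p.2 ∧ shiftMap^[p.2] p.1 = p.1},
    ((birkhoff φ p.1.2 p.1.1 / (p.1.2 : ℝ) : ℝ) : EReal)

/-- `x` lies in a cylinder belonging to `B(n, M', q)`: it is admissible,
`x 0 ≤ q`, `x n ≤ q` and `#{0 ≤ k ≤ n : x k ≤ q} ≤ (n+1)/M'`. -/
def inBSet (M : ℕ → ℕ → Prop) (n M' q : ℕ) (x : Pt) : Prop :=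
  isAdmissible M x ∧ x 0 ≤ q ∧ x n ≤ q ∧
    ((((Finset.range (n + 1)).filter (fun k => x k ≤ q)).card : ℝ) ≤ (n + 1 : ℝ) / (M' : ℝ))

/-- `z_{φ,n}(M',q) = sup { (1/n) S_n φ(x) : x ∈ B for some B ∈ B(n,M',q) }`. -/
noncomputable def zPhi (M : ℕ → ℕ → Prop) (φ : Pt → ℝ) (n M' q : ℕ) : EReal :=
  ⨆ x : {x : Pt // inBSet M n M' q x}, ((birkhoff φ n x.1 / (n : ℝ) : ℝ) : EReal)

/-- The contraction at infinity
`δ_{φ,∞} = lim_{q→∞} lim_{M'→∞} limsup_{n→∞} z_{φ,n}(M',q)`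
(the inner limits exist by monotonicity, so they agree with `liminf`s). -/
noncomputable def deltaInf (M : ℕ → ℕ → Prop) (φ : Pt → ℝ) : EReal :=
  liminf (fun q : ℕ => liminf (fun M' : ℕ =>
    limsup (fun n : ℕ => zPhi M φ n M' q) atTop) atTop) atTop

/-- `z_n(M',q) = #B(n,M',q)`, the number of `(n+1)`-cylinders (i.e. admissible
words realized in `Σ`) in `B(n,M',q)`, counted in `ℝ≥0∞`. -/
noncomputable def zCount (M : ℕ → ℕ → Prop) (n M' q : ℕ) : ℝ≥0∞ :=
  ∑' _w : {w : Fin (n + 1) → ℕ //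
      (∃ x : Pt, isAdmissible M x ∧ ∀ i : Fin (n + 1), x (i : ℕ) = w i) ∧
      w 0 ≤ q ∧ w (Fin.last n) ≤ q ∧
      (((Finset.univ.filter (fun i : Fin (n + 1) => w i ≤ q)).card : ℝ) ≤ (n + 1 : ℝ) / (M' : ℝ))},
    (1 : ℝ≥0∞)

/-- The entropy at infinity
`h_∞ = lim_{q→∞} lim_{M'→∞} limsup_{n→∞} (1/n) log z_n(M',q)`. -/
noncomputable def hInfty (M : ℕ → ℕ → Prop) : EReal :=
  liminf (fun q : ℕ => liminf (fun M' : ℕ =>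
    limsup (fun n : ℕ => ((n : ℝ)⁻¹ : EReal) * ENNReal.log (zCount M n M' q)) atTop) atTop) atTop

end CMS

open CMS

namespace CMS

theorem shiftMap_iterate (n : ℕ) (x : Pt) (i : ℕ) : shiftMap^[n] x i = x (i + n) := by
  induction n generalizing x with
  | zero => rfl
  | succ k ih =>
    rw [Function.iterate_succ_apply, ih]
    simp only [shiftMap]
    congr 1

theorem isAdmissible.iterate {M : ℕ → ℕ → Prop} {x : Pt} (hx : isAdmissible M x) (n : ℕ) :
    isAdmissible M (shiftMap^[n] x) := by
  intro i
  rw [shiftMap_iterate, shiftMap_iterate, Nat.add_right_comm]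
  exact hx _

/-- Bounded distortion: Birkhoff sums of a potential with summable variations along orbits
sharing the same `(n+1)`-cylinder differ by a constant independent of `n`. -/
theorem SummableVariations.exists_birkhoff_sub_le {M : ℕ → ℕ → Prop} {ψ : Pt → ℝ}
    (h : SummableVariations M ψ) :
    ∃ D : ℝ, ∀ (n : ℕ) (x y : Pt), isAdmissible M x → isAdmissible M y →
      (∀ i ≤ n, x i = y i) → |birkhoff ψ n x - birkhoff ψ n y| ≤ D := by
  obtain ⟨V, hV, hvar⟩ := h
  refine ⟨∑' k, |V k|, fun n x y hx hy hxy => ?_⟩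
  have hterm : ∀ i ∈ Finset.range n,
      |ψ (shiftMap^[i] x) - ψ (shiftMap^[i] y)| ≤ |V (n - 1 - i + 2)| := by
    intro i hi
    rw [Finset.mem_range] at hi
    refine (hvar (n - 1 - i + 2) (by omega) _ _ (hx.iterate i) (hy.iterate i) ?_).trans
      (le_abs_self _)
    intro j hj
    rw [shiftMap_iterate, shiftMap_iterate]
    exact hxy _ (by omega)
  calc |birkhoff ψ n x - birkhoff ψ n y|
      = |∑ i ∈ Finset.range n, (ψ (shiftMap^[i] x) - ψ (shiftMap^[i] y))| := by
        rw [Finset.sum_sub_distrib, birkhoff, birkhoff]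
    _ ≤ ∑ i ∈ Finset.range n, |ψ (shiftMap^[i] x) - ψ (shiftMap^[i] y)| :=
        Finset.abs_sum_le_sum_abs _ _
    _ ≤ ∑ i ∈ Finset.range n, |V (n - 1 - i + 2)| := Finset.sum_le_sum hterm
    _ = ∑ j ∈ Finset.range n, |V (j + 2)| :=
        Finset.sum_range_reflect (fun j => |V (j + 2)|) n
    _ ≤ ∑ j ∈ Finset.range (n + 2), |V j| := by
        rw [Finset.sum_range_succ', Finset.sum_range_succ']
        linarith [abs_nonneg (V 0), abs_nonneg (V (0 + 1))]
    _ ≤ ∑' k, |V k| := hV.abs.sum_le_tsum _ fun _ _ => abs_nonneg _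

theorem SummableVariations.sub {M : ℕ → ℕ → Prop} {φ ψ : Pt → ℝ}
    (hφ : SummableVariations M φ) (hψ : SummableVariations M ψ) :
    SummableVariations M (fun x => φ x - ψ x) := by
  obtain ⟨V, hV, hv⟩ := hφ
  obtain ⟨W, hW, hw⟩ := hψ
  refine ⟨fun k => V k + W k, hV.add hW, fun k hk x y hx hy hxy => ?_⟩
  have h1 := abs_le.1 (hv k hk x y hx hy hxy)
  have h2 := abs_le.1 (hw k hk x y hx hy hxy)
  exact abs_le.2 ⟨by linarith, by linarith⟩

theorem birkhoff_coboundary (ξ : Pt → ℝ) (n : ℕ) (x : Pt) :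
    birkhoff (fun x => ξ x - ξ (shiftMap x)) n x = ξ x - ξ (shiftMap^[n] x) := by
  have := Finset.sum_range_sub' (fun i => ξ (shiftMap^[i] x)) n
  simpa only [birkhoff, Function.iterate_succ_apply', Function.iterate_zero, id] using this

/-- Closing lemma: an orbit segment from `x 0` to `x n` followed by one from `x n` back to `x 0`
is shadowed by a periodic orbit. -/
theorem exists_periodic_concat {M : ℕ → ℕ → Prop} {x c : Pt} {n p : ℕ} (hn : 0 < n)
    (hx : isAdmissible M x) (hc : isAdmissible M c) (h0 : c 0 = x n) (hp : c p = x 0) :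
    ∃ y : Pt, isAdmissible M y ∧ shiftMap^[n + p] y = y ∧ (∀ i ≤ n, x i = y i) ∧
      ∀ i ≤ p, c i = shiftMap^[n] y i := by
  set z : Pt := fun i => if i < n then x i else c (i - n) with hz
  have hzx : ∀ i ≤ n, z i = x i := by
    intro i hi
    rcases hi.lt_or_eq with h | rfl
    · simp [hz, h]
    · simp [hz, h0]
  have hzc : ∀ i, z (i + n) = c i := fun i => by simp [hz]
  have hzadm : isAdmissible M z := by
    intro i
    rcases lt_or_ge i n with h | h
    · rw [hzx i h.le, hzx (i + 1) h]
      exact hx i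
    · obtain ⟨j, rfl⟩ := Nat.exists_eq_add_of_le' h
      rw [hzc, Nat.add_right_comm, hzc]
      exact hc j
  have hzm : z (n + p) = z 0 := by rw [Nat.add_comm, hzc, hp, hzx 0 hn.le]
  have hyz : ∀ i ≤ n + p, z (i % (n + p)) = z i := by
    intro i hi
    rcases hi.lt_or_eq with h | rfl
    · rw [Nat.mod_eq_of_lt h]
    · rw [Nat.mod_self, hzm]
  refine ⟨fun i => z (i % (n + p)), fun i => ?_, ?_, fun i hi => ?_, fun i hi => ?_⟩
  · have hlt : i % (n + p) < n + p := Nat.mod_lt _ (by omega)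
    have : z ((i + 1) % (n + p)) = z (i % (n + p) + 1) := by
      rw [← hyz (i % (n + p) + 1) hlt, Nat.mod_add_mod]
    simpa only [this] using hzadm (i % (n + p))
  · funext i
    rw [shiftMap_iterate, Nat.add_mod_right]
  · simp only [hyz i (show i ≤ n + p by omega), hzx i hi]
  · simp only [shiftMap_iterate, hyz (i + n) (show i + n ≤ n + p by omega), hzc]

/-- A coboundary with summable variations has Birkhoff sums that are uniformly bounded over
orbit segments starting and ending in a given finite set of states. -/
theorem exists_abs_coboundary_le {M : ℕ → ℕ → Prop} {ξ : Pt → ℝ} (htrans : TopTransitive M)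
    (h : SummableVariations M (fun x => ξ x - ξ (shiftMap x))) (q : ℕ) :
    ∃ C : ℝ, ∀ (n : ℕ) (x : Pt), 0 < n → isAdmissible M x → x 0 ≤ q → x n ≤ q →
      |ξ x - ξ (shiftMap^[n] x)| ≤ C := by
  obtain ⟨D, hD⟩ := h.exists_birkhoff_sub_le
  simp only [birkhoff_coboundary] at hD
  choose p c hc hc0 hcp using htrans
  set f : ℕ × ℕ → ℝ := fun s => |ξ (c s.1 s.2) - ξ (shiftMap^[p s.1 s.2] (c s.1 s.2))| with hf
  refine ⟨2 * D + ∑ s ∈ Finset.range (q + 1) ×ˢ Finset.range (q + 1), f s,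
    fun n x hn hx h0 hxn => ?_⟩
  obtain ⟨y, hy, hper, hxy, hcy⟩ := exists_periodic_concat hn hx (hc (x n) (x 0))
    (hc0 _ _) (hcp _ _)
  have h1 := abs_le.1 (hD n x y hx hy hxy)
  have h2 := abs_le.1 (hD _ _ _ (hc (x n) (x 0)) (hy.iterate n) hcy)
  rw [← Function.iterate_add_apply, Nat.add_comm, hper] at h2
  have h3 : f (x n, x 0) ≤ ∑ s ∈ Finset.range (q + 1) ×ˢ Finset.range (q + 1), f s :=
    Finset.single_le_sum (fun _ _ => abs_nonneg _)
      (by simp only [Finset.mem_product, Finset.mem_range]; omega)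
  have h4 := abs_le.1 (le_refl (f (x n, x 0)))
  exact abs_le.2 ⟨by linarith, by linarith⟩

/-- Adding a coboundary does not increase the contraction at infinity. -/
theorem deltaInf_add_coboundary_le {M : ℕ → ℕ → Prop} {φ ξ : Pt → ℝ} (htrans : TopTransitive M)
    (hsum : SummableVariations M φ)
    (hsum' : SummableVariations M (fun x => φ x + ξ x - ξ (shiftMap x))) :
    deltaInf M (fun x => φ x + ξ x - ξ (shiftMap x)) ≤ deltaInf M φ := by
  have hcob : SummableVariations M (fun x => ξ x - ξ (shiftMap x)) := by
    convert hsum'.sub hsum using 2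
    ring
  refine liminf_le_liminf (Eventually.of_forall fun q => ?_)
  refine liminf_le_liminf (Eventually.of_forall fun m => ?_)
  obtain ⟨C, hC⟩ := exists_abs_coboundary_le htrans hcob q
  have hlim : limsup (fun n : ℕ => ((C / n : ℝ) : EReal)) atTop = 0 :=
    (EReal.tendsto_coe.2 (tendsto_const_div_atTop_nhds_zero_nat C)).limsup_eq
  have hle : ∀ᶠ n : ℕ in atTop,
      zPhi M (fun x => φ x + ξ x - ξ (shiftMap x)) n m q ≤
        zPhi M φ n m q + ((C / n : ℝ) : EReal) := by
    filter_upwards [eventually_gt_atTop 0] with n hn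
    refine iSup_le fun x => ?_
    refine le_trans ?_ (add_le_add_left (le_iSup _ x) _)
    rw [← EReal.coe_add, EReal.coe_le_coe_iff, ← add_div]
    refine div_le_div_of_nonneg_right ?_ n.cast_nonneg
    have hsplit : birkhoff (fun x => φ x + ξ x - ξ (shiftMap x)) n x.1 =
        birkhoff φ n x.1 + birkhoff (fun x => ξ x - ξ (shiftMap x)) n x.1 := by
      simp only [birkhoff, ← Finset.sum_add_distrib, add_sub_assoc]
    rw [hsplit, birkhoff_coboundary]
    have := (abs_le.1 (hC n x.1 hn x.2.1 x.2.2.1 x.2.2.2.1)).2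
    linarith
  refine (limsup_le_limsup hle).trans ((EReal.limsup_add_le ?_ ?_).trans ?_)
  · exact Or.inr (by simp [hlim])
  · exact Or.inr (by simp [hlim])
  · rw [hlim, add_zero]

end CMS

/-- Lemma `lem:phi'`, for general coboundaries.
For a topologically transitive countable Markov shift with the F-property and a
potential `φ` with summable variations and Gurevich pressure `P(φ) = 0`: if
`ξ : Σ → ℝ` is such that `φ' = φ + ξ - ξ ∘ σ` has summable variations and
`δ_{φ,∞} < 0`, then `δ_{φ',∞} < 0`. -/
theorem deltaInf_coboundary
    (M : ℕ → ℕ → Prop) (φ ξ : Pt → ℝ)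
    (htrans : TopTransitive M) (hF : FProperty M)
    (hsum : SummableVariations M φ)
    (hP : ∀ a : ℕ, pressureAt M φ a = (0 : EReal))
    (hsum' : SummableVariations M (fun x => φ x + ξ x - ξ (shiftMap x)))
    (hCI : deltaInf M φ < (0 : EReal)) :
    deltaInf M (fun x => φ x + ξ x - ξ (shiftMap x)) < (0 : EReal) := by
  exact (deltaInf_add_coboundary_le htrans hsum hsum').trans_lt hCI
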